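/- arXiv:1009.2923 — 2 statements merged into one kernel-verified Lean document; each statement's English description precedes it below -/
import Mathlib

section
/- Let X = (⊕_{n=1}^∞ ℓ₁ⁿ)_{c₀}. Then {0}, the set 𝒦(X) of compact operators on X, and the norm closure 𝒢̄_{c₀}(X) of the set of operators on X factoring through c₀ are closed two-sided ideals of the Banach algebra B(X), and the inclusions {0} ⊊ 𝒦(X) ⊊ 𝒢̄_{c₀}(X) ⊊ B(X) are all strict. -/
open MeasureTheory Filter Topology

noncomputable section

/-- `ℓ₁ⁿ`, i.e. `ℝⁿ` with the norm `‖a‖₁ = ∑ |aᵢ|`. -/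
abbrev ell1 (n : ℕ) : Type := PiLp 1 (fun _ : Fin n => ℝ)

/-- The `ℓ∞`-sum of the spaces `ℓ₁ⁿ`. -/
abbrev preX : Type := lp (fun n : ℕ => ell1 n) ⊤

/-- The subspace of the `ℓ∞`-sum consisting of sequences with `‖xₙ‖₁ → 0`;
this is the `c₀`-direct sum `X = (⊕ₙ ℓ₁ⁿ)_{c₀}`. -/
def XSub : Submodule ℝ preX where
  carrier := {f | Tendsto (fun n => ‖f n‖) atTop (𝓝 0)}
  zero_mem' := by
    simpa using (tendsto_const_nhds : Tendsto (fun _ : ℕ => (0:ℝ)) atTop (𝓝 0))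
  add_mem' := by
    intro f g hf hg
    have h : Tendsto (fun n => ‖f n‖ + ‖g n‖) atTop (𝓝 0) := by
      simpa using hf.add hg
    refine squeeze_zero (fun n => norm_nonneg _) (fun n => ?_) h
    have : (↑(f + g) : ∀ n, ell1 n) n = f n + g n := by
      rw [lp.coeFn_add]; rfl
    rw [this]
    exact norm_add_le _ _
  smul_mem' := by
    intro c f hf
    have h : Tendsto (fun n => ‖c‖ * ‖f n‖) atTop (𝓝 0) := by
      simpa using hf.const_mul ‖c‖
    refine squeeze_zero (fun n => norm_nonneg _) (fun n => ?_) h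
    have : (↑(c • f) : ∀ n, ell1 n) n = c • f n := by
      rw [lp.coeFn_smul]; rfl
    rw [this, norm_smul]

/-- The Banach space `X = (⊕ₙ ℓ₁ⁿ)_{c₀}`. -/
abbrev Xsp : Type := ↥XSub


/-- The Banach space `c₀` of real sequences converging to `0`, with the sup norm. -/
abbrev c0 : Type := ZeroAtInftyContinuousMap ℕ ℝ

/-- A set of operators on `X` is a closed two-sided ideal if it is norm closed, contains
`0`, and is stable under addition and under composition with arbitrary operators on
either side. -/
def IsClosedOperatorIdeal (S : Set (Xsp →L[ℝ] Xsp)) : Prop :=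
  IsClosed S ∧ (0 : Xsp →L[ℝ] Xsp) ∈ S ∧
    (∀ T U : Xsp →L[ℝ] Xsp, T ∈ S → U ∈ S → T + U ∈ S) ∧
    (∀ T ∈ S, ∀ U : Xsp →L[ℝ] Xsp, U.comp T ∈ S ∧ T.comp U ∈ S)

/-- The compact operators on `X`. -/
def Kset : Set (Xsp →L[ℝ] Xsp) := {T | IsCompactOperator (T : Xsp → Xsp)}

/-- The operators on `X` factoring through `c₀`. -/
def GcoSet : Set (Xsp →L[ℝ] Xsp) :=
  {T | ∃ A : Xsp →L[ℝ] c0, ∃ B : c0 →L[ℝ] Xsp, T = B.comp A}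

/-! ### Basic facts about `c₀` -/

lemma c0_tendsto (f : c0) : Tendsto f atTop (𝓝 0) := by
  have := f.zero_at_infty'
  rwa [cocompact_eq_cofinite, Nat.cofinite_eq_atTop] at this

/-- Build an element of `c₀`. -/
def mkC0 (f : ℕ → ℝ) (h : Tendsto f atTop (𝓝 0)) : c0 where
  toFun := f
  continuous_toFun := continuous_of_discreteTopology
  zero_at_infty' := by
    rw [cocompact_eq_cofinite, Nat.cofinite_eq_atTop]; exact h

@[simp] lemma mkC0_apply (f : ℕ → ℝ) (h) (n : ℕ) : mkC0 f h n = f n := rfl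

lemma c0_norm_le {f : c0} {C : ℝ} (hC : 0 ≤ C) (h : ∀ n, |f n| ≤ C) : ‖f‖ ≤ C := by
  rw [← ZeroAtInftyContinuousMap.norm_toBCF_eq_norm]
  exact (BoundedContinuousFunction.norm_le hC).2 h

lemma c0_apply_le (f : c0) (n : ℕ) : |f n| ≤ ‖f‖ := by
  rw [← ZeroAtInftyContinuousMap.norm_toBCF_eq_norm]
  exact BoundedContinuousFunction.norm_coe_le_norm f.toBCF n

/-- Linear maps into `c₀` given coordinatewise. -/
def mkToC0 {E : Type*} [NormedAddCommGroup E] [NormedSpace ℝ E] (φ : ℕ → E →L[ℝ] ℝ) (C : ℝ)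
    (hC : 0 ≤ C) (hφ : ∀ n x, |φ n x| ≤ C * ‖x‖)
    (h : ∀ x, Tendsto (fun n => φ n x) atTop (𝓝 0)) : E →L[ℝ] c0 :=
  LinearMap.mkContinuous
    { toFun := fun x => mkC0 (fun n => φ n x) (h x)
      map_add' := fun x y => by ext n; simp
      map_smul' := fun c x => by ext n; simp } C
    (fun x => c0_norm_le (by positivity) (fun n => hφ n x))

@[simp] lemma mkToC0_apply {E : Type*} [NormedAddCommGroup E] [NormedSpace ℝ E]
    (φ : ℕ → E →L[ℝ] ℝ) (C : ℝ) (hC hφ h) (x : E) (n : ℕ) :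
    mkToC0 φ C hC hφ h x n = φ n x := rfl

/-- Evaluation functionals on `c₀`. -/
def evC0 (n : ℕ) : c0 →L[ℝ] ℝ :=
  LinearMap.mkContinuous
    { toFun := fun f => f n
      map_add' := fun _ _ => rfl
      map_smul' := fun _ _ => rfl } 1
    (fun f => by simpa using c0_apply_le f n)

@[simp] lemma evC0_apply (n : ℕ) (f : c0) : evC0 n f = f n := rfl

/-- Unit vectors of `c₀`. -/
def δ0 (k : ℕ) : c0 := mkC0 (Pi.single k 1) (by
  refine tendsto_const_nhds.congr' ?_
  filter_upwards [eventually_gt_atTop k] with n hn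
  simp [hn.ne'])

lemma δ0_apply (k n : ℕ) : δ0 k n = if n = k then 1 else 0 := by
  simp [δ0, Pi.single_apply]

lemma c0_sum_apply (K : ℕ) (c : ℕ → ℝ) (n : ℕ) :
    (∑ k ∈ Finset.range K, c k • δ0 k : c0) n = if n < K then c n else 0 := by
  rw [← evC0_apply, map_sum]
  simp [δ0_apply]

lemma c0_trunc_tendsto (f : c0) :
    Tendsto (fun K => ∑ k ∈ Finset.range K, f k • δ0 k) atTop (𝓝 f) := by
  rw [Metric.tendsto_atTop]
  intro ε hε
  obtain ⟨N, hN⟩ := Metric.tendsto_atTop.1 (c0_tendsto f) (ε/2) (half_pos hε)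
  refine ⟨N, fun K hK => ?_⟩
  rw [dist_eq_norm]
  refine lt_of_le_of_lt (c0_norm_le (half_pos hε).le fun n => ?_) (half_lt_self hε)
  rw [ZeroAtInftyContinuousMap.sub_apply, c0_sum_apply]
  split_ifs with h
  · simpa using (half_pos hε).le
  · have := (hN n (by omega)).le
    simpa [dist_eq_norm] using this

/-! ### Basic facts about `X` -/

/-- Coordinate map. -/
def coX (n : ℕ) : Xsp →L[ℝ] ell1 n := (lp.evalCLM ℝ (fun n => ell1 n) ⊤ n).comp XSub.subtypeL

lemma coX_apply (n : ℕ) (x : Xsp) : coX n x = x.1 n := rfl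

lemma coX_norm_le (n : ℕ) (x : Xsp) : ‖coX n x‖ ≤ ‖x‖ :=
  lp.norm_apply_le_norm (by simp) x.1 n

lemma X_norm_le {x : Xsp} {C : ℝ} (hC : 0 ≤ C) (h : ∀ n, ‖coX n x‖ ≤ C) : ‖x‖ ≤ C :=
  lp.norm_le_of_forall_le (f := x.1) hC h

lemma X_tendsto (x : Xsp) : Tendsto (fun n => ‖coX n x‖) atTop (𝓝 0) := x.2

lemma X_ext {x y : Xsp} (h : ∀ n, coX n x = coX n y) : x = y := by
  apply Subtype.ext
  apply lp.ext
  funext n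
  exact h n

/-- Build elements of `X`. -/
def mkX (f : ∀ n, ell1 n) (h : Tendsto (fun n => ‖f n‖) atTop (𝓝 0)) : Xsp :=
  ⟨⟨f, memℓp_infty h.bddAbove_range⟩, h⟩

@[simp] lemma coX_mkX (f : ∀ n, ell1 n) (h) (n : ℕ) : coX n (mkX f h) = f n := rfl

/-- Unit vectors of `X`. -/
def eX (n : ℕ) (j : Fin n) : Xsp := mkX (Pi.single n (PiLp.single 1 j (1:ℝ))) (by
  refine tendsto_const_nhds.congr' ?_
  filter_upwards [eventually_gt_atTop n] with m hm
  rw [Pi.single_eq_of_ne hm.ne', norm_zero])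

lemma coX_eX_same (n : ℕ) (j : Fin n) : coX n (eX n j) = PiLp.single 1 j (1:ℝ) := by
  simp [eX]

lemma coX_eX_ne {n m : ℕ} (h : m ≠ n) (j : Fin n) : coX m (eX n j) = 0 := by
  simp [eX, Pi.single_eq_of_ne h]

lemma norm_eX_le (n : ℕ) (j : Fin n) : ‖eX n j‖ ≤ 1 := by
  refine X_norm_le zero_le_one fun m => ?_
  by_cases h : m = n
  · subst h
    rw [coX_eX_same]; simp
  · rw [coX_eX_ne h]; simp

lemma one_le_norm_eX_sub {n m : ℕ} (h : n ≠ m) (i : Fin n) (j : Fin m) :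
    1 ≤ ‖eX n i - eX m j‖ := by
  have := coX_norm_le n (eX n i - eX m j)
  rwa [map_sub, coX_eX_same, coX_eX_ne h, sub_zero, PiLp.norm_single, norm_one] at this

/-- Scalar coordinate functionals. -/
def cX (n : ℕ) (j : Fin n) : Xsp →L[ℝ] ℝ := (PiLp.proj 1 (fun _ : Fin n => ℝ) j).comp (coX n)

lemma cX_apply (n : ℕ) (j : Fin n) (x : Xsp) : cX n j x = coX n x j := rfl

lemma cX_le (n : ℕ) (j : Fin n) (x : Xsp) : |cX n j x| ≤ ‖coX n x‖ := by
  rw [cX_apply]; exact PiLp.norm_apply_le (coX n x) j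

lemma sum_cX_eq (n : ℕ) (x : Xsp) : ∑ j, |cX n j x| = ‖coX n x‖ := by
  rw [PiLp.norm_eq_of_L1]; rfl

lemma sum_cX_le (n : ℕ) (x : Xsp) : ∑ j, |cX n j x| ≤ ‖x‖ := by
  rw [sum_cX_eq]; exact coX_norm_le n x

/-! ### Completeness -/

lemma XSub_isClosed : IsClosed (XSub : Set preX) := by
  rw [← closure_subset_iff_isClosed]
  intro f hf
  change Tendsto (fun n => ‖f n‖) atTop (𝓝 0)
  rw [Metric.tendsto_atTop]
  intro ε hε
  obtain ⟨g, hg, hfg⟩ := Metric.mem_closure_iff.1 hf (ε/2) (half_pos hε)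
  obtain ⟨N, hN⟩ := Metric.tendsto_atTop.1 (show Tendsto (fun n => ‖g n‖) atTop (𝓝 0) from hg)
    (ε/2) (half_pos hε)
  refine ⟨N, fun n hn => ?_⟩
  have h1 := hN n hn
  have h2 : ‖f n - g n‖ ≤ ‖f - g‖ := lp.norm_apply_le_norm (by simp) (f - g) n
  rw [dist_eq_norm] at hfg
  have h3 : ‖f n‖ ≤ ‖f n - g n‖ + ‖g n‖ := by
    simpa using norm_add_le (f n - g n) (g n)
  simp only [dist_zero_right, norm_norm] at h1 ⊢
  linarith

instance Xsp_complete : CompleteSpace Xsp := XSub_isClosed.completeSpace_coe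

/-! ### The set `GcoSet` -/

lemma Gco_comp_left {T : Xsp →L[ℝ] Xsp} (hT : T ∈ GcoSet) (U : Xsp →L[ℝ] Xsp) :
    U.comp T ∈ GcoSet := by
  obtain ⟨A, B, rfl⟩ := hT
  exact ⟨A, U.comp B, rfl⟩

lemma Gco_comp_right {T : Xsp →L[ℝ] Xsp} (hT : T ∈ GcoSet) (U : Xsp →L[ℝ] Xsp) :
    T.comp U ∈ GcoSet := by
  obtain ⟨A, B, rfl⟩ := hT
  exact ⟨A.comp U, B, rfl⟩

lemma Gco_zero : (0 : Xsp →L[ℝ] Xsp) ∈ GcoSet := ⟨0, 0, by simp⟩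

/-- Restriction to an arithmetic progression `2n+i`. -/
def resC0 (i : ℕ) : c0 →L[ℝ] c0 :=
  mkToC0 (fun n => evC0 (2 * n + i)) 1 zero_le_one
    (fun n x => by simpa using c0_apply_le x (2 * n + i))
    (fun x => (c0_tendsto x).comp
      (tendsto_atTop_mono (fun n => (by simp; omega : id n ≤ 2 * n + i)) tendsto_id))

/-- Interleaving of two operators. -/
def interC0 (A₁ A₂ : Xsp →L[ℝ] c0) : Xsp →L[ℝ] c0 :=
  mkToC0 (fun n => if n % 2 = 0 then (evC0 (n / 2)).comp A₁ else (evC0 (n / 2)).comp A₂)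
    (‖A₁‖ + ‖A₂‖) (by positivity)
    (fun n x => by
      have h1 := (c0_apply_le (A₁ x) (n/2)).trans (A₁.le_opNorm x)
      have h2 := (c0_apply_le (A₂ x) (n/2)).trans (A₂.le_opNorm x)
      have h3 : 0 ≤ ‖A₁‖ * ‖x‖ := by positivity
      have h4 : 0 ≤ ‖A₂‖ * ‖x‖ := by positivity
      split_ifs
      · change |A₁ x (n/2)| ≤ _
        linarith [add_mul ‖A₁‖ ‖A₂‖ ‖x‖]
      · change |A₂ x (n/2)| ≤ _
        linarith [add_mul ‖A₁‖ ‖A₂‖ ‖x‖])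
    (fun x => by
      have hd : Tendsto (fun n : ℕ => n / 2) atTop atTop :=
        Nat.tendsto_div_const_atTop (by norm_num)
      have h1 := ((c0_tendsto (A₁ x)).comp hd).norm
      have h2 := ((c0_tendsto (A₂ x)).comp hd).norm
      have h3 := h1.add h2
      simp only [norm_zero, add_zero] at h3
      refine squeeze_zero_norm (fun n => ?_) h3
      split_ifs
      · simp
      · simp)

lemma Gco_add {T U : Xsp →L[ℝ] Xsp} (hT : T ∈ GcoSet) (hU : U ∈ GcoSet) : T + U ∈ GcoSet := by
  obtain ⟨A₁, B₁, rfl⟩ := hT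
  obtain ⟨A₂, B₂, rfl⟩ := hU
  refine ⟨interC0 A₁ A₂, B₁.comp (resC0 0) + B₂.comp (resC0 1), ?_⟩
  ext1 x
  have h1 : resC0 0 (interC0 A₁ A₂ x) = A₁ x := by
    ext n; simp [resC0, interC0]
  have h2 : resC0 1 (interC0 A₁ A₂ x) = A₂ x := by
    ext n
    have : (2 * n + 1) / 2 = n := by omega
    have h3 : (2 * n + 1) % 2 ≠ 0 := by omega
    change (if (2 * n + 1) % 2 = 0 then (evC0 ((2 * n + 1) / 2)).comp A₁
      else (evC0 ((2 * n + 1) / 2)).comp A₂) x = _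
    rw [if_neg h3, this]
    rfl
  simp [h1, h2]

/-- Rank-one operators. -/
def rk1 (φ : Xsp →L[ℝ] ℝ) (v : Xsp) : Xsp →L[ℝ] Xsp := φ.smulRight v

lemma rk1_apply (φ : Xsp →L[ℝ] ℝ) (v x : Xsp) : rk1 φ v x = φ x • v := rfl

lemma Gco_rk1 (φ : Xsp →L[ℝ] ℝ) (v : Xsp) : rk1 φ v ∈ GcoSet := by
  refine ⟨φ.smulRight (δ0 0), (evC0 0).smulRight v, ?_⟩
  ext1 x
  simp [rk1, δ0_apply]

lemma Gco_sum {ι : Type*} (s : Finset ι) (T : ι → Xsp →L[ℝ] Xsp) (h : ∀ i, T i ∈ GcoSet) :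
    ∑ i ∈ s, T i ∈ GcoSet := by
  classical
  induction s using Finset.induction_on with
  | empty => simpa using Gco_zero
  | insert a s ha ih => rw [Finset.sum_insert ha]; exact Gco_add (h a) ih

set_option synthInstance.maxHeartbeats 400000 in
lemma Gco_closure_ideal : IsClosedOperatorIdeal (closure GcoSet) := by
  refine ⟨isClosed_closure, subset_closure Gco_zero, fun T U hT hU => ?_, fun T hT U => ⟨?_, ?_⟩⟩
  · exact map_mem_closure₂ continuous_add hT hU (fun a ha b hb => Gco_add ha hb)
  · exact map_mem_closure (f := fun T : Xsp →L[ℝ] Xsp => U.comp T) (by fun_prop) hT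
      (fun a ha => Gco_comp_left ha U)
  · exact map_mem_closure (f := fun T : Xsp →L[ℝ] Xsp => T.comp U) (by fun_prop) hT
      (fun a ha => Gco_comp_right ha U)

lemma Kset_ideal : IsClosedOperatorIdeal Kset := by
  refine ⟨isClosed_setOfPred_isCompactOperator, isCompactOperator_zero,
    fun T U hT hU => IsCompactOperator.add hT hU, fun T hT U => ⟨?_, ?_⟩⟩
  · exact IsCompactOperator.clm_comp hT U
  · exact IsCompactOperator.comp_clm hT U

lemma zero_ideal : IsClosedOperatorIdeal {(0 : Xsp →L[ℝ] Xsp)} := by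
  refine ⟨isClosed_singleton, rfl, ?_, ?_⟩
  · rintro T U rfl rfl; simp
  · rintro T rfl U; simp

/-! ### Compact operators lie in the closure of `GcoSet` -/

/-- Coordinate projections. -/
def PX (N : ℕ) : Xsp →L[ℝ] Xsp := ∑ n ∈ Finset.range N, ∑ j : Fin n, rk1 (cX n j) (eX n j)

lemma Gco_PX (N : ℕ) : PX N ∈ GcoSet :=
  Gco_sum _ _ fun _ => Gco_sum _ _ fun _ => Gco_rk1 _ _

lemma coX_block (m n : ℕ) (x : Xsp) :
    ∑ j : Fin n, cX n j x • coX m (eX n j) = if m = n then coX m x else 0 := by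
  split_ifs with h
  · subst h
    ext i
    simp [coX_eX_same, cX_apply, Pi.single_apply]
  · simp [coX_eX_ne h]

lemma coX_PX (N m : ℕ) (x : Xsp) : coX m (PX N x) = if m < N then coX m x else 0 := by
  have : PX N x = ∑ n ∈ Finset.range N, ∑ j : Fin n, cX n j x • eX n j := by
    simp [PX, rk1_apply]
  rw [this, map_sum]
  simp only [map_sum, map_smul, coX_block]
  simp

lemma coX_sub_PX (N m : ℕ) (x : Xsp) :
    coX m (x - PX N x) = if m < N then 0 else coX m x := by
  rw [map_sub, coX_PX]; split_ifs <;> simp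

lemma norm_sub_PX_le (N : ℕ) (x : Xsp) : ‖x - PX N x‖ ≤ ‖x‖ := by
  refine X_norm_le (norm_nonneg _) fun m => ?_
  rw [coX_sub_PX]
  split_ifs
  · rw [norm_zero]; exact norm_nonneg x
  · exact coX_norm_le m x

lemma PX_eventually (x : Xsp) {ε : ℝ} (hε : 0 < ε) : ∀ᶠ N in atTop, ‖x - PX N x‖ ≤ ε := by
  obtain ⟨N, hN⟩ := Metric.tendsto_atTop.1 (X_tendsto x) ε hε
  filter_upwards [eventually_ge_atTop N] with M hM
  refine X_norm_le hε.le fun m => ?_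
  rw [coX_sub_PX]
  split_ifs with h
  · rw [norm_zero]; exact hε.le
  · have := hN m (by omega)
    rw [dist_zero_right, norm_norm] at this
    exact this.le

lemma clm_mem_closure_iff {E F : Type*} [NormedAddCommGroup E] [NormedSpace ℝ E]
    [NormedAddCommGroup F] [NormedSpace ℝ F] {S : Set (E →L[ℝ] F)} {T : E →L[ℝ] F} :
    T ∈ closure S ↔ ∀ ε > 0, ∃ U ∈ S, ‖T - U‖ < ε := by
  simp_rw [← dist_eq_norm]
  exact Metric.mem_closure_iff

lemma Kset_subset : Kset ⊆ closure GcoSet := by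
  intro T hT
  rw [clm_mem_closure_iff]
  intro ε hε
  obtain ⟨K, hK, hTK⟩ := IsCompactOperator.image_closedBall_subset_compact
    (f := (T : Xsp →ₗ[ℝ] Xsp)) hT 1
  have hε4 : 0 < ε / 4 := by positivity
  obtain ⟨t, htf, ht⟩ := Metric.totallyBounded_iff.1 hK.totallyBounded (ε / 4) hε4
  have hev : ∀ᶠ N in atTop, ∀ y ∈ t, ‖y - PX N y‖ ≤ ε / 4 :=
    (Set.Finite.eventually_all htf).2 fun y _ => PX_eventually y hε4
  obtain ⟨N, hN⟩ := hev.exists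
  refine ⟨(PX N).comp T, Gco_comp_right (Gco_PX N) T, ?_⟩
  refine lt_of_le_of_lt (b := ε / 2) ?_ (half_lt_self hε)
  refine ContinuousLinearMap.opNorm_le_of_unit_norm (half_pos hε).le fun x hx => ?_
  have hxK : T x ∈ K := hTK ⟨x, by simp [Metric.mem_closedBall, dist_zero_right, hx], rfl⟩
  obtain ⟨y, hy, hxy⟩ := Set.mem_iUnion₂.1 (ht hxK)
  rw [Metric.mem_ball, dist_eq_norm] at hxy
  have e : (T - (PX N).comp T) x = ((T x - y) - PX N (T x - y)) + (y - PX N y) := by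
    rw [map_sub, ContinuousLinearMap.sub_apply, ContinuousLinearMap.comp_apply]; abel
  rw [e]
  have h1 := norm_add_le ((T x - y) - PX N (T x - y)) (y - PX N y)
  have h2 := norm_sub_PX_le N (T x - y)
  have h3 := hN y hy
  linarith

/-! ### A non-compact operator factoring through `c₀` -/

/-- First coordinates of the blocks. -/
def diagA : Xsp →L[ℝ] c0 :=
  mkToC0 (fun k => cX (k + 1) 0) 1 zero_le_one
    (fun k x => by simpa using (cX_le (k+1) 0 x).trans (coX_norm_le (k+1) x))
    (fun x => squeeze_zero_norm (fun k => cX_le (k+1) 0 x)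
      ((tendsto_add_atTop_iff_nat 1).2 (X_tendsto x)))

/-- Auxiliary vector. -/
def diagF (y : ℕ → ℝ) : ∀ n, ell1 n
  | 0 => 0
  | (k + 1) => y k • PiLp.single 1 0 (1:ℝ)

lemma diagF_norm (y : ℕ → ℝ) (k : ℕ) : ‖diagF y (k+1)‖ = |y k| := by
  simp [diagF, norm_smul]

/-- Embedding of `c₀` as the first coordinates of the blocks. -/
def diagB : c0 →L[ℝ] Xsp :=
  LinearMap.mkContinuous
    { toFun := fun y => mkX (diagF y) (by
        rw [← tendsto_add_atTop_iff_nat 1]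
        simp only [diagF_norm]
        simpa using (c0_tendsto y).norm)
      map_add' := fun y z => by
        refine X_ext fun n => ?_
        rw [map_add, coX_mkX, coX_mkX, coX_mkX]
        cases n with
        | zero => simp [diagF]
        | succ k => simp [diagF, add_smul]
      map_smul' := fun c y => by
        refine X_ext fun n => ?_
        rw [map_smul, coX_mkX, coX_mkX]
        cases n with
        | zero => simp [diagF]
        | succ k => simp [diagF, mul_smul] } 1
    (fun y => by
      rw [one_mul]
      refine X_norm_le (norm_nonneg _) fun n => ?_
      change ‖diagF y n‖ ≤ _
      cases n with
      | zero => simp [diagF]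
      | succ k => rw [diagF_norm]; exact c0_apply_le y k)

lemma diag_eX (k : ℕ) : diagB.comp diagA (eX (k+1) 0) = eX (k+1) 0 := by
  refine X_ext fun n => ?_
  change diagF (fun m => cX (m+1) 0 (eX (k+1) 0)) n = _
  cases n with
  | zero => rw [coX_eX_ne (by omega)]; rfl
  | succ m =>
    by_cases h : m = k
    · subst h
      simp [diagF, cX_apply, coX_eX_same]
    · rw [coX_eX_ne (by omega)]
      simp [diagF, cX_apply, coX_eX_ne (show m + 1 ≠ k + 1 by omega)]

lemma diag_not_compact : diagB.comp diagA ∉ Kset := by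
  intro hT
  obtain ⟨K, hK, hTK⟩ := IsCompactOperator.image_closedBall_subset_compact
    (f := ((diagB.comp diagA : Xsp →L[ℝ] Xsp) : Xsp →ₗ[ℝ] Xsp)) hT 1
  have hmem : ∀ k : ℕ, eX (k+1) 0 ∈ K := fun k =>
    hTK ⟨eX (k+1) 0, by
      rw [Metric.mem_closedBall, dist_zero_right]; exact norm_eX_le _ _, diag_eX k⟩
  obtain ⟨a, -, φ, hφ, hlim⟩ := hK.tendsto_subseq hmem
  obtain ⟨N, hN⟩ := Metric.cauchySeq_iff.1 hlim.cauchySeq 1 one_pos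
  have h := hN N le_rfl (N+1) (by omega)
  rw [dist_eq_norm] at h
  have hne : φ N + 1 ≠ φ (N+1) + 1 := by
    have := hφ (Nat.lt_succ_self N)
    simp only [Nat.succ_eq_add_one] at this
    omega
  exact absurd h (not_lt.2 (one_le_norm_eX_sub hne 0 0))

lemma zero_ssubset : {(0 : Xsp →L[ℝ] Xsp)} ⊂ Kset := by
  refine ⟨?_, fun h => ?_⟩
  · rintro T rfl; exact isCompactOperator_zero
  · have hm : rk1 (cX 1 0) (eX 1 0) ∈ Kset := by
      have h1 : IsCompactOperator (ContinuousLinearMap.id ℝ ℝ : ℝ → ℝ) :=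
        isCompactOperator_of_locallyCompactSpace_dom _
      exact (h1.clm_comp ((ContinuousLinearMap.id ℝ ℝ).smulRight (eX 1 0))).comp_clm (cX 1 0)
    have h0 : rk1 (cX 1 0) (eX 1 0) = 0 := h hm
    have h1 : cX 1 0 (rk1 (cX 1 0) (eX 1 0) (eX 1 0)) = 0 := by rw [h0]; simp
    rw [rk1_apply, map_smul, cX_apply, coX_eX_same] at h1
    simp at h1

/-! ### Khinchine's inequality -/

/-- Signs. -/
def sg (b : Bool) : ℝ := if b then 1 else -1

lemma sum_cons_bool {n : ℕ} (F : (Fin (n+1) → Bool) → ℝ) :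
    ∑ e, F e = ∑ e : Fin n → Bool, (F (Fin.cons true e) + F (Fin.cons false e)) := by
  rw [← (Fin.consEquiv (fun _ : Fin (n+1) => Bool)).sum_comp, Fintype.sum_prod_type,
    Fintype.sum_bool, ← Finset.sum_add_distrib]
  rfl

lemma khin2 (n : ℕ) (c : Fin n → ℝ) :
    ∑ e : Fin n → Bool, (∑ j, sg (e j) * c j) ^ 2 = 2 ^ n * ∑ j, c j ^ 2 := by
  induction n with
  | zero => simp
  | succ n ih =>
    rw [sum_cons_bool]
    have := ih (fun j => c j.succ)
    simp only [Fin.sum_univ_succ, Fin.cons_zero, Fin.cons_succ]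
    have h : ∀ e : Fin n → Bool,
        (sg true * c 0 + ∑ j, sg (e j) * c j.succ) ^ 2
          + (sg false * c 0 + ∑ j, sg (e j) * c j.succ) ^ 2
        = 2 * (∑ j, sg (e j) * c j.succ) ^ 2 + 2 * c 0 ^ 2 := by
      intro e; simp only [sg]; simp; ring
    simp only [h, Finset.sum_add_distrib, ← Finset.mul_sum, this]
    simp
    ring

lemma khin4 (n : ℕ) (c : Fin n → ℝ) :
    ∑ e : Fin n → Bool, (∑ j, sg (e j) * c j) ^ 4 ≤ 3 * 2 ^ n * (∑ j, c j ^ 2) ^ 2 := by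
  induction n with
  | zero => simp
  | succ n ih =>
    rw [sum_cons_bool]
    have h4 := ih (fun j => c j.succ)
    have h2 := khin2 n (fun j => c j.succ)
    simp only [Fin.sum_univ_succ, Fin.cons_zero, Fin.cons_succ]
    have h : ∀ e : Fin n → Bool,
        (sg true * c 0 + ∑ j, sg (e j) * c j.succ) ^ 4
          + (sg false * c 0 + ∑ j, sg (e j) * c j.succ) ^ 4
        = 2 * (∑ j, sg (e j) * c j.succ) ^ 4 + 12 * c 0 ^ 2 * (∑ j, sg (e j) * c j.succ) ^ 2
          + 2 * c 0 ^ 4 := by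
      intro e; simp only [sg]; simp; ring
    simp only [h, Finset.sum_add_distrib, ← Finset.mul_sum, h2]
    simp
    have hp : (0:ℝ) ≤ 2 ^ n * c 0 ^ 4 := by positivity
    rw [pow_succ (2:ℝ)]
    nlinarith

lemma khin1 (n : ℕ) (c : Fin n → ℝ) :
    2 ^ n * √(∑ j, c j ^ 2) ≤ 2 * ∑ e : Fin n → Bool, |∑ j, sg (e j) * c j| := by
  set σ := √(∑ j, c j ^ 2) with hσ
  have hnn : 0 ≤ ∑ j, c j ^ 2 := Finset.sum_nonneg fun _ _ => sq_nonneg _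
  have hσ2 : σ ^ 2 = ∑ j, c j ^ 2 := Real.sq_sqrt hnn
  rcases (Real.sqrt_nonneg (∑ j, c j ^ 2)).eq_or_lt with h0 | hpos
  · rw [hσ, ← h0, mul_zero]
    exact mul_nonneg (by norm_num) (Finset.sum_nonneg fun _ _ => abs_nonneg _)
  rw [← hσ] at hpos
  have key : ∀ s : ℝ, 6 * σ ^ 2 * s ^ 2 - s ^ 4 ≤ 6 * σ ^ 3 * |s| := by
    intro s
    rw [← sq_abs s, show s ^ 4 = |s| ^ 4 by rw [show (4:ℕ) = 2 * 2 by rfl, pow_mul, pow_mul, sq_abs]]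
    set u := |s|
    have hu : 0 ≤ u := abs_nonneg s
    have : 0 ≤ 6 * σ ^ 3 - 6 * σ ^ 2 * u + u ^ 3 := by
      nlinarith [mul_nonneg (add_nonneg hu (mul_nonneg (by norm_num : (0:ℝ) ≤ 2.84) hpos.le)) (sq_nonneg (u - 1.42 * σ)), mul_nonneg hu (sq_nonneg σ), pow_pos hpos 3]
    nlinarith [mul_nonneg hu this]
  have hs := Finset.sum_le_sum (s := (Finset.univ : Finset (Fin n → Bool)))
    fun e _ => key (∑ j, sg (e j) * c j)
  rw [Finset.sum_sub_distrib, ← Finset.mul_sum, ← Finset.mul_sum, khin2, ← hσ2] at hs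
  have h4 := khin4 n c
  rw [← hσ2] at h4
  have h6 : 3 * σ ^ 3 * (2 ^ n * σ) ≤ 3 * σ ^ 3 * (2 * ∑ e : Fin n → Bool, |∑ j, sg (e j) * c j|) := by
    nlinarith
  exact le_of_mul_le_mul_left h6 (by positivity)

/-- The trace estimate. -/
lemma trace_est (n K : ℕ) (a b : Fin n → ℕ → ℝ) (α β : ℝ) (hα : 0 ≤ α)
    (ha : ∀ j k, |a j k| ≤ α)
    (hb : ∀ e : Fin n → Bool, ∑ k ∈ Finset.range K, |∑ j, sg (e j) * b j k| ≤ β) :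
    ∑ j, ∑ k ∈ Finset.range K, a j k * b j k ≤ 2 * α * β * √n := by
  have h1 : ∀ k, ∑ j, a j k * b j k ≤ α * √n * √(∑ j, b j k ^ 2) := by
    intro k
    refine (Real.sum_mul_le_sqrt_mul_sqrt _ _ _).trans ?_
    gcongr
    rw [Real.sqrt_le_left (by positivity), mul_pow, Real.sq_sqrt (by positivity)]
    calc ∑ j, a j k ^ 2 ≤ ∑ j : Fin n, α ^ 2 :=
          Finset.sum_le_sum fun j _ => by
            rw [← sq_abs]; exact pow_le_pow_left₀ (abs_nonneg _) (ha j k) 2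
      _ = α ^ 2 * n := by simp [mul_comm]
  have h2 : 2 ^ n * ∑ k ∈ Finset.range K, √(∑ j, b j k ^ 2) ≤ 2 ^ n * (2 * β) := by
    rw [Finset.mul_sum]
    calc _ ≤ ∑ k ∈ Finset.range K, 2 * ∑ e : Fin n → Bool, |∑ j, sg (e j) * b j k| :=
          Finset.sum_le_sum fun k _ => khin1 n fun j => b j k
      _ = 2 * ∑ e : Fin n → Bool, ∑ k ∈ Finset.range K, |∑ j, sg (e j) * b j k| := by
          rw [← Finset.mul_sum, Finset.sum_comm]
      _ ≤ 2 * ∑ e : Fin n → Bool, β := by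
          gcongr with e; exact hb e
      _ = 2 ^ n * (2 * β) := by simp; ring
  have h3 := le_of_mul_le_mul_left h2 (by positivity)
  rw [Finset.sum_comm]
  calc _ ≤ ∑ k ∈ Finset.range K, α * √n * √(∑ j, b j k ^ 2) :=
        Finset.sum_le_sum fun k _ => h1 k
    _ = α * √n * ∑ k ∈ Finset.range K, √(∑ j, b j k ^ 2) := by rw [Finset.mul_sum]
    _ ≤ α * √n * (2 * β) := by gcongr
    _ = _ := by ring

lemma sg_abs (b : Bool) : |sg b| = 1 := by cases b <;> simp [sg]

/-- The identity is not approximable by operators factoring through `c₀`. -/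
lemma id_not_mem : ContinuousLinearMap.id ℝ Xsp ∉ closure GcoSet := by
  intro h
  obtain ⟨T, ⟨A, B, rfl⟩, hT⟩ := clm_mem_closure_iff.1 h (1/2) (by norm_num)
  have hmain : ∀ n : ℕ, (n : ℝ) / 2 ≤ 2 * ‖A‖ * ‖B‖ * √n := by
    intro n
    -- the coefficients
    have hlow : ∀ j : Fin n, 1 / 2 ≤ cX n j (B (A (eX n j))) := by
      intro j
      have h1 := (ContinuousLinearMap.id ℝ Xsp - B.comp A).le_opNorm (eX n j)
      have h2 := (cX_le n j ((ContinuousLinearMap.id ℝ Xsp - B.comp A) (eX n j))).trans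
        (coX_norm_le n _)
      have h3 := norm_eX_le n j
      have h4 : cX n j ((ContinuousLinearMap.id ℝ Xsp - B.comp A) (eX n j))
          = 1 - cX n j (B (A (eX n j))) := by
        rw [ContinuousLinearMap.sub_apply, map_sub]
        congr 1
        simp [cX_apply, coX_eX_same]
      rw [h4] at h2
      have h5 := le_abs_self (1 - cX n j (B (A (eX n j))))
      have h6 : ‖ContinuousLinearMap.id ℝ Xsp - B.comp A‖ * ‖eX n j‖ ≤ 1/2 * 1 :=
        mul_le_mul hT.le h3 (norm_nonneg _) (by norm_num)
      linarith
    have hlim : Tendsto (fun K => ∑ j : Fin n, ∑ k ∈ Finset.range K,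
        A (eX n j) k * cX n j (B (δ0 k))) atTop (𝓝 (∑ j : Fin n, cX n j (B (A (eX n j))))) := by
      refine tendsto_finsetSum _ fun j _ => ?_
      have := (((cX n j).comp B).continuous.tendsto _).comp (c0_trunc_tendsto (A (eX n j)))
      refine this.congr fun K => ?_
      simp [map_sum]
    have hbd : ∀ K, ∑ j : Fin n, ∑ k ∈ Finset.range K,
        A (eX n j) k * cX n j (B (δ0 k)) ≤ 2 * ‖A‖ * ‖B‖ * √n := by
      intro K
      refine trace_est n K (fun j k => A (eX n j) k) (fun j k => cX n j (B (δ0 k))) ‖A‖ ‖B‖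
        A.opNorm_nonneg (fun j k => ?_) (fun e => ?_)
      · refine (c0_apply_le _ k).trans ((A.le_opNorm _).trans ?_)
        exact mul_le_of_le_one_right A.opNorm_nonneg (norm_eX_le n j)
      · set θ : ℕ → ℝ := fun k => SignType.sign (∑ j, sg (e j) * cX n j (B (δ0 k))) with hθ
        set y : c0 := ∑ k ∈ Finset.range K, θ k • δ0 k with hy
        have hθ1 : ∀ k, |θ k| ≤ 1 := by
          intro k
          simp only [hθ]
          cases SignType.sign (∑ j, sg (e j) * cX n j (B (δ0 k))) <;> simp
        have hy1 : ‖y‖ ≤ 1 := by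
          refine c0_norm_le zero_le_one fun m => ?_
          rw [hy, c0_sum_apply]
          split_ifs
          · exact hθ1 m
          · simp
        calc ∑ k ∈ Finset.range K, |∑ j, sg (e j) * cX n j (B (δ0 k))|
            = ∑ k ∈ Finset.range K, θ k * ∑ j, sg (e j) * cX n j (B (δ0 k)) := by
              refine Finset.sum_congr rfl fun k _ => ?_
              rw [hθ, sign_mul_self]
          _ = ∑ j, sg (e j) * cX n j (B y) := by
              simp only [hy, map_sum, map_smul, Finset.mul_sum, smul_eq_mul]
              rw [Finset.sum_comm]
              refine Finset.sum_congr rfl fun j _ => Finset.sum_congr rfl fun k _ => ?_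
              ring
          _ ≤ ∑ j, |cX n j (B y)| := by
              refine Finset.sum_le_sum fun j _ => (le_abs_self _).trans ?_
              rw [abs_mul, sg_abs, one_mul]
          _ ≤ ‖B y‖ := sum_cX_le n _
          _ ≤ ‖B‖ * ‖y‖ := B.le_opNorm y
          _ ≤ ‖B‖ := mul_le_of_le_one_right B.opNorm_nonneg hy1
    have h1 := le_of_tendsto' hlim hbd
    have h2 : ∑ j : Fin n, (1/2 : ℝ) ≤ ∑ j : Fin n, cX n j (B (A (eX n j))) :=
      Finset.sum_le_sum fun j _ => hlow j
    simp only [Finset.sum_const, Finset.card_univ, Fintype.card_fin, nsmul_eq_mul] at h2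
    linarith
  obtain ⟨m, hm⟩ := exists_nat_gt (4 * ‖A‖ * ‖B‖)
  have h1 := hmain (m * m)
  have hm0 : (0:ℝ) < m := lt_of_le_of_lt (by positivity) hm
  rw [Nat.cast_mul, Real.sqrt_mul_self hm0.le] at h1
  nlinarith

/-- **The basic chain of closed ideals in `B(X)` for `X = (⊕ₙ ℓ₁ⁿ)_{c₀}`.**
`{0}`, the compact operators `𝒦(X)` and the closure `𝒢̄_{c₀}(X)` of the operators
factoring through `c₀` are closed two-sided ideals, and the inclusions
`{0} ⊊ 𝒦(X) ⊊ 𝒢̄_{c₀}(X) ⊊ B(X)` are all strict. -/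
theorem closed_ideal_chain :
    IsClosedOperatorIdeal {(0 : Xsp →L[ℝ] Xsp)} ∧
    IsClosedOperatorIdeal Kset ∧
    IsClosedOperatorIdeal (closure GcoSet) ∧
    {(0 : Xsp →L[ℝ] Xsp)} ⊂ Kset ∧ Kset ⊂ closure GcoSet ∧
    closure GcoSet ⊂ (Set.univ : Set (Xsp →L[ℝ] Xsp)) := by
  refine ⟨zero_ideal, Kset_ideal, Gco_closure_ideal, zero_ssubset, ⟨Kset_subset, fun h => ?_⟩,
    ⟨Set.subset_univ _, fun h => id_not_mem (h (Set.mem_univ _))⟩⟩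
  exact diag_not_compact (h (subset_closure ⟨diagA, diagB, rfl⟩))

end
end

section
/- Let X = (⊕_{n=1}^∞ ℓ₁ⁿ)_{c₀} and let T ∈ B(X) be a non-compact operator. Then the identity operator on c₀ factors through T: there exist bounded operators A : c₀ → X and B : X → c₀ with B ∘ T ∘ A = id_{c₀}. Consequently, the closed two-sided ideal of B(X) generated by T contains 𝒢̄_{c₀}(X). -/
open MeasureTheory Filter Topology

noncomputable section

namespace NC

/-- Constructor for elements of `X`. -/
def mk (f : ∀ n, ell1 n) (h : Tendsto (fun n => ‖f n‖) atTop (𝓝 0)) : Xsp :=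
  ⟨⟨f, memℓp_infty h.bddAbove_range⟩, h⟩

/-- The `n`-th coordinate. -/
def co (x : Xsp) (n : ℕ) : ell1 n := (x : preX) n

@[simp] lemma co_mk (f : ∀ n, ell1 n) (h) (n : ℕ) : co (mk f h) n = f n := rfl

@[ext] lemma xext {x y : Xsp} (h : ∀ n, co x n = co y n) : x = y := by
  apply Subtype.ext
  apply lp.ext
  funext n
  exact h n

@[simp] lemma co_add (x y : Xsp) (n : ℕ) : co (x + y) n = co x n + co y n := rfl
@[simp] lemma co_sub (x y : Xsp) (n : ℕ) : co (x - y) n = co x n - co y n := rfl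
@[simp] lemma co_smul (c : ℝ) (x : Xsp) (n : ℕ) : co (c • x) n = c • co x n := rfl
@[simp] lemma co_zero (n : ℕ) : co 0 n = 0 := rfl
@[simp] lemma co_neg (x : Xsp) (n : ℕ) : co (-x) n = -co x n := rfl

lemma co_tendsto (x : Xsp) : Tendsto (fun n => ‖co x n‖) atTop (𝓝 0) := x.2

lemma norm_co_le (x : Xsp) (n : ℕ) : ‖co x n‖ ≤ ‖x‖ :=
  lp.norm_apply_le_norm (by simp) (x : preX) n

lemma norm_le {x : Xsp} {C : ℝ} (hC : 0 ≤ C) (h : ∀ n, ‖co x n‖ ≤ C) : ‖x‖ ≤ C :=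
  lp.norm_le_of_forall_le (f := (x : preX)) hC h

/-- The coordinate as a continuous linear map. -/
def coL (n : ℕ) : Xsp →L[ℝ] ell1 n :=
  LinearMap.mkContinuous
    { toFun := fun x => co x n, map_add' := fun _ _ => rfl, map_smul' := fun _ _ => rfl } 1
    (fun x => by rw [one_mul]; exact norm_co_le x n)

@[simp] lemma coL_apply (n : ℕ) (x : Xsp) : coL n x = co x n := rfl

lemma co_sum {ι : Type*} (s : Finset ι) (f : ι → Xsp) (n : ℕ) :
    co (∑ i ∈ s, f i) n = ∑ i ∈ s, co (f i) n := by
  exact map_sum (coL n) f s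

open Classical in
/-- Restriction to a set of coordinates. -/
def R (s : Set ℕ) : Xsp →L[ℝ] Xsp :=
  LinearMap.mkContinuous
    { toFun := fun x => mk (fun n => if n ∈ s then co x n else 0)
        (squeeze_zero (fun _ => norm_nonneg _)
          (fun n => by split_ifs <;> simp) (co_tendsto x))
      map_add' := fun x y => by
        ext1 n
        simp only [co_mk, co_add]
        split_ifs <;> simp
      map_smul' := fun c x => by
        ext1 n
        simp only [co_mk, co_smul, RingHom.id_apply]
        split_ifs <;> simp } 1
    (fun x => by
      rw [one_mul]
      refine norm_le (norm_nonneg _) fun n => ?_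
      simp only [LinearMap.coe_mk, AddHom.coe_mk, co_mk]
      split_ifs
      · exact norm_co_le x n
      · simp)

open Classical in
lemma co_R (s : Set ℕ) (x : Xsp) (n : ℕ) : co (R s x) n = if n ∈ s then co x n else 0 := rfl

lemma norm_R_le (s : Set ℕ) (x : Xsp) : ‖R s x‖ ≤ ‖x‖ := by
  refine norm_le (norm_nonneg _) fun n => ?_
  rw [co_R]
  split_ifs
  · exact norm_co_le x n
  · simp

lemma R_add_compl (N : ℕ) (x : Xsp) : R (Set.Iio N) x + R (Set.Ici N) x = x := by
  ext1 n
  simp only [co_add, co_R, Set.mem_Iio, Set.mem_Ici]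
  by_cases h : n < N
  · simp [h, not_le.2 h]
  · simp [h, not_lt.1 h]

lemma R_tendsto (x : Xsp) : Tendsto (fun K => R (Set.Iio K) x) atTop (𝓝 x) := by
  rw [Metric.tendsto_atTop]
  intro ε hε
  obtain ⟨K, hK⟩ := Metric.tendsto_atTop.1 (co_tendsto x) (ε / 2) (half_pos hε)
  refine ⟨K, fun L hL => ?_⟩
  rw [dist_eq_norm]
  refine lt_of_le_of_lt (norm_le (half_pos hε).le fun n => ?_) (half_lt_self hε)
  simp only [co_sub, co_R, Set.mem_Iio]
  split_ifs with h
  · simpa using (half_pos hε).le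
  · have := hK n (by omega)
    simp at this
    simpa using this.le

instance : CompleteSpace Xsp := by
  have : IsClosed (XSub : Set preX) := by
    rw [← isSeqClosed_iff_isClosed]
    intro u f hu huf
    change Tendsto (fun n => ‖f n‖) atTop (𝓝 0)
    rw [Metric.tendsto_atTop]
    intro ε hε
    obtain ⟨m, hm⟩ := Metric.tendsto_atTop.1 huf (ε / 2) (half_pos hε)
    obtain ⟨K, hK⟩ := Metric.tendsto_atTop.1 (hu m) (ε / 2) (half_pos hε)
    refine ⟨K, fun n hn => ?_⟩
    have h1 := hK n hn
    have h2 := hm m le_rfl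
    rw [dist_eq_norm] at h2
    have h3 : ‖u m n - f n‖ ≤ ‖u m - f‖ := lp.norm_apply_le_norm (by simp) (u m - f) n
    have h4 : ‖f n‖ ≤ ‖u m n‖ + ‖u m n - f n‖ := norm_le_norm_add_norm_sub _ _
    simp only [dist_zero_right, norm_norm] at h1 ⊢
    linarith
  exact this.completeSpace_coe

/-- The unit vectors. -/
def e (n : ℕ) (i : Fin n) : Xsp :=
  mk (Pi.single n (PiLp.single 1 i (1 : ℝ))) (by
    refine tendsto_const_nhds.congr' ?_
    filter_upwards [eventually_gt_atTop n] with m hm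
    rw [Pi.single_eq_of_ne hm.ne', norm_zero])

/-- Scalar coordinates. -/
def cs (n : ℕ) (i : Fin n) : Xsp →L[ℝ] ℝ := (PiLp.proj 1 (fun _ : Fin n => ℝ) i).comp (coL n)

lemma cs_apply (n : ℕ) (i : Fin n) (x : Xsp) : cs n i x = co x n i := rfl

lemma abs_cs_le (n : ℕ) (i : Fin n) (x : Xsp) : |cs n i x| ≤ ‖x‖ :=
  (PiLp.norm_apply_le (co x n) i).trans (norm_co_le x n)

lemma R_eq_sum (N : ℕ) (x : Xsp) :
    R (Set.Iio N) x = ∑ n ∈ Finset.range N, ∑ i : Fin n, cs n i x • e n i := by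
  ext1 m
  simp only [co_R, co_sum, co_smul, e, co_mk, Set.mem_Iio]
  have key : ∀ n ∈ Finset.range N, n ≠ m → ∑ i : Fin n, cs n i x •
      (Pi.single n (PiLp.single 1 i (1 : ℝ)) : ∀ n, ell1 n) m = 0 := by
    intro n _ hnm
    refine Finset.sum_eq_zero fun i _ => ?_
    rw [Pi.single_eq_of_ne hnm.symm, smul_zero]
  split_ifs with h
  · rw [Finset.sum_eq_single_of_mem m (Finset.mem_range.2 h) key]
    simp only [Pi.single_eq_same, cs_apply]
    ext j
    simp [Pi.single_apply]
  · symm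
    refine Finset.sum_eq_zero fun n hn => key n hn ?_
    have := Finset.mem_range.1 hn
    omega

lemma R_compact (N : ℕ) : IsCompactOperator (R (Set.Iio N) : Xsp → Xsp) := by
  have h : (R (Set.Iio N)) =
      ∑ n ∈ Finset.range N, ∑ i : Fin n, (cs n i).smulRight (e n i) := by
    ext1 x
    rw [R_eq_sum]
    simp [ContinuousLinearMap.sum_apply]
  rw [h]
  have h1 : ∀ n (i : Fin n), IsCompactOperator ((cs n i).smulRight (e n i) : Xsp → Xsp) := by
    intro n i
    have : IsCompactOperator (cs n i : Xsp → ℝ) :=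
      (isCompactOperator_id_iff_locallyCompactSpace (E := ℝ).2 inferInstance).comp_clm (cs n i)
    exact this.clm_comp (ContinuousLinearMap.toSpanSingleton ℝ (e n i))
  have h2 : ∀ {ι : Type} (s : Finset ι) (f : ι → Xsp →L[ℝ] Xsp),
      (∀ i ∈ s, IsCompactOperator (f i : Xsp → Xsp)) →
      IsCompactOperator ((∑ i ∈ s, f i : Xsp →L[ℝ] Xsp) : Xsp → Xsp) := by
    intro ι s f hf
    refine Finset.sum_induction f (fun T => IsCompactOperator (T : Xsp → Xsp)) ?_ ?_ hf
    · intro a b ha hb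
      exact ha.add hb
    · exact isCompactOperator_zero
  exact h2 _ _ fun n _ => h2 _ _ fun i _ => h1 n i

lemma lower (T : Xsp →L[ℝ] Xsp) (N : ℕ) {ε : ℝ} (hε : 0 < ε) :
    ∃ M, ∀ m, M ≤ m → ∀ x, ‖co (T (R (Set.Iio N) x)) m‖ ≤ ε * ‖x‖ := by
  have h : Tendsto (fun m => ∑ n ∈ Finset.range N, ∑ i : Fin n, ‖co (T (e n i)) m‖)
      atTop (𝓝 0) := by
    have := tendsto_finsetSum (Finset.range N) (fun n _ =>
      tendsto_finsetSum (Finset.univ : Finset (Fin n)) (fun i _ => co_tendsto (T (e n i))))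
    simpa using this
  obtain ⟨M, hM⟩ := eventually_atTop.1 (h.eventually (gt_mem_nhds hε))
  refine ⟨M, fun m hm x => ?_⟩
  rw [R_eq_sum]
  simp only [map_sum, map_smul, co_sum, co_smul]
  calc _ ≤ ∑ n ∈ Finset.range N, ∑ i : Fin n, ‖x‖ * ‖co (T (e n i)) m‖ := by
        refine (norm_sum_le _ _).trans (Finset.sum_le_sum fun n _ => ?_)
        refine (norm_sum_le _ _).trans (Finset.sum_le_sum fun i _ => ?_)
        rw [norm_smul]
        gcongr
        exact abs_cs_le n i x
    _ = (∑ n ∈ Finset.range N, ∑ i : Fin n, ‖co (T (e n i)) m‖) * ‖x‖ := by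
        simp only [← Finset.mul_sum]
        ring
    _ ≤ ε * ‖x‖ := by
        gcongr
        exact (hM m hm).le

lemma tailg (g : Xsp →L[ℝ] ℝ) {ε : ℝ} (hε : 0 < ε) :
    ∃ N, ∀ M, N ≤ M → ∀ x, |g (R (Set.Ici M) x)| ≤ ε * ‖x‖ := by
  by_contra! hcon
  have step : ∀ m : ℕ, ∃ y K, R (Set.Iio K) y = y ∧ ‖y‖ ≤ 1 ∧ m * ε ≤ g y := by
    intro m
    induction m with
    | zero => exact ⟨0, 0, by simp, by simp, by simp⟩
    | succ m ih =>
      obtain ⟨y, K, hy, hy1, hyg⟩ := ih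
      obtain ⟨M, hM, x, hx⟩ := hcon K
      have hx0 : 0 < ‖x‖ := by
        rw [norm_pos_iff]
        rintro rfl
        simp at hx
      -- normalise
      obtain ⟨z, hz1, hzg⟩ : ∃ z : Xsp, ‖z‖ ≤ 1 ∧ ε < g (R (Set.Ici M) z) := by
        rcases lt_abs.1 hx with h | h
        · refine ⟨‖x‖⁻¹ • x, ?_, ?_⟩
          · rw [norm_smul, norm_inv, norm_norm, inv_mul_cancel₀ hx0.ne']
          · rw [map_smul, map_smul, smul_eq_mul, inv_mul_eq_div, lt_div_iff₀ hx0]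
            exact h
        · refine ⟨-(‖x‖⁻¹ • x), ?_, ?_⟩
          · rw [norm_neg, norm_smul, norm_inv, norm_norm, inv_mul_cancel₀ hx0.ne']
          · rw [map_neg, map_smul, map_neg, map_smul, smul_eq_mul, ← mul_neg, inv_mul_eq_div,
              lt_div_iff₀ hx0]
            exact h
      have ht : Tendsto (fun L => g (R (Set.Iio L) (R (Set.Ici M) z))) atTop
          (𝓝 (g (R (Set.Ici M) z))) := (g.continuous.tendsto _).comp (R_tendsto _)
      obtain ⟨L, hLg, hLM⟩ := ((ht.eventually (lt_mem_nhds hzg)).and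
        (eventually_ge_atTop K)).exists
      refine ⟨y + R (Set.Iio L) (R (Set.Ici M) z), L, ?_, ?_, ?_⟩
      · ext1 n
        have hyn : co y n = if n < K then co y n else 0 := by
          conv_lhs => rw [← hy]
          simp [co_R]
        simp only [co_R, co_add, Set.mem_Iio, Set.mem_Ici]
        by_cases h1 : n < L
        · simp only [if_pos h1]
        · rw [hyn, if_neg (show ¬ n < K by omega)]
          simp [h1]
      · refine norm_le zero_le_one fun n => ?_
        have hyn : co y n = if n < K then co y n else 0 := by
          conv_lhs => rw [← hy]
          simp [co_R]
        have h1 := (norm_co_le y n).trans hy1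
        have h2 := (norm_co_le z n).trans hz1
        simp only [co_R, co_add, Set.mem_Iio, Set.mem_Ici]
        by_cases hn : n < K
        · rw [if_neg (show ¬ M ≤ n by omega)]
          simpa using h1
        · rw [hyn, if_neg hn]
          split_ifs <;> simp [h2]
      · rw [map_add]
        push_cast
        linarith
  obtain ⟨m, hm⟩ := exists_nat_gt (‖g‖ / ε)
  obtain ⟨y, K, -, hy1, hyg⟩ := step m
  rw [div_lt_iff₀ hε] at hm
  have h1 : g y ≤ ‖g‖ * ‖y‖ := (le_abs_self _).trans (g.le_opNorm y)
  have h2 : ‖g‖ * ‖y‖ ≤ ‖g‖ * 1 := by gcongr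
  linarith

lemma large (T : Xsp →L[ℝ] Xsp) (hT : ¬ IsCompactOperator (T : Xsp → Xsp)) :
    ∃ δ > 0, ∀ N M, ∃ x, ‖x‖ ≤ 1 ∧ R (Set.Ici N) x = x ∧ ∃ n, M ≤ n ∧ δ < ‖co (T x) n‖ := by
  by_contra! hcon
  apply hT
  have hcl : IsClosed {f : Xsp →L[ℝ] Xsp | IsCompactOperator f} :=
    isClosed_setOfPred_isCompactOperator
  have : T ∈ closure {f : Xsp →L[ℝ] Xsp | IsCompactOperator f} := by
    refine (Metric.mem_closure_iff (α := Xsp →L[ℝ] Xsp)).2 ?_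
    intro ε hε
    obtain ⟨N, M, h⟩ := hcon (ε / 2) (half_pos hε)
    refine ⟨T.comp (R (Set.Iio N)) + (R (Set.Iio M)).comp (T.comp (R (Set.Ici N))), ?_, ?_⟩
    · have h1 : IsCompactOperator (T.comp (R (Set.Iio N)) : Xsp → Xsp) :=
        (R_compact N).clm_comp T
      have h2 : IsCompactOperator
          ((R (Set.Iio M)).comp (T.comp (R (Set.Ici N))) : Xsp → Xsp) :=
        (R_compact M).comp_clm (T.comp (R (Set.Ici N)))
      exact h1.add h2
    · refine (dist_eq_norm (E := Xsp →L[ℝ] Xsp) _ _).trans_lt ?_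
      refine lt_of_le_of_lt ?_ (half_lt_self hε)
      refine ContinuousLinearMap.opNorm_le_of_unit_norm (half_pos hε).le fun x hx => ?_
      have heq : (T - (T.comp (R (Set.Iio N)) + (R (Set.Iio M)).comp (T.comp (R (Set.Ici N))))) x
          = R (Set.Ici M) (T (R (Set.Ici N) x)) := by
        have e1 := R_add_compl N x
        have e2 := R_add_compl M (T (R (Set.Ici N) x))
        have e3 : T x = T (R (Set.Iio N) x) + T (R (Set.Ici N) x) := by rw [← map_add, e1]
        simp only [ContinuousLinearMap.sub_apply, ContinuousLinearMap.add_apply,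
          ContinuousLinearMap.comp_apply]
        rw [e3, add_sub_add_left_eq_sub, sub_eq_iff_eq_add, add_comm]
        exact e2.symm
      rw [heq]
      refine norm_le (half_pos hε).le fun n => ?_
      rw [co_R]
      split_ifs with hn
      · refine h (R (Set.Ici N) x) ((norm_R_le _ _).trans hx.le) ?_ n hn
        ext1 m
        simp only [co_R]
        split_ifs <;> rfl
      · simpa using (half_pos hε).le
  rwa [hcl.closure_eq] at this

lemma step (T : Xsp →L[ℝ] Xsp) (hT : ¬ IsCompactOperator (T : Xsp → Xsp)) :
    ∃ C > 0, ∀ N : ℕ, ∃ (x : Xsp) (n : ℕ) (f : Xsp →L[ℝ] ℝ) (N' : ℕ),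
      N ≤ n ∧ n < N' ∧ ‖x‖ ≤ 1 ∧ (∀ m, m < N ∨ N' ≤ m → co x m = 0) ∧
      (∀ y, |f y| ≤ C * ‖co y n‖) ∧ f (T x) = 1 ∧
      (∀ y, |f (T (R (Set.Iio N) y))| ≤ 1 / 4 * ‖y‖) ∧
      (∀ y, |f (T (R (Set.Ici N') y))| ≤ 1 / 4 * ‖y‖) := by
  obtain ⟨δ, hδ, hL⟩ := large T hT
  refine ⟨δ⁻¹, inv_pos.2 hδ, fun N => ?_⟩
  obtain ⟨M, hM⟩ := lower T N (ε := δ / 4) (by positivity)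
  obtain ⟨z, hz1, hzN, n, hn, hnδ⟩ := hL N (max M N)
  have ht : Tendsto (fun L => ‖coL n (T (R (Set.Iio L) z))‖) atTop (𝓝 ‖coL n (T z)‖) :=
    ((((coL n).comp T).continuous.norm).tendsto z).comp (R_tendsto z)
  obtain ⟨L, hLδ⟩ := (ht.eventually (lt_mem_nhds hnδ)).exists
  set x := R (Set.Iio L) z with hx
  obtain ⟨φ, hφ1, hφ⟩ := exists_dual_vector'' ℝ (co (T x) n)
  have hpos : 0 < ‖co (T x) n‖ := hδ.trans hLδ
  set f : Xsp →L[ℝ] ℝ := (‖co (T x) n‖)⁻¹ • (φ.comp (coL n)) with hf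
  have hfb : ∀ y, |f y| ≤ δ⁻¹ * ‖co y n‖ := by
    intro y
    simp only [hf, ContinuousLinearMap.smul_apply, ContinuousLinearMap.comp_apply, coL_apply,
      smul_eq_mul, abs_mul, abs_inv, abs_norm]
    have : |φ (co y n)| ≤ 1 * ‖co y n‖ := (φ.le_opNorm _).trans (by gcongr)
    rw [one_mul] at this
    gcongr
    exact hLδ.le
  obtain ⟨N', hN'⟩ := tailg (f.comp T) (ε := 1 / 4) (by norm_num)
  refine ⟨x, n, f, max N' (max L (n + 1)), (le_max_right _ _).trans hn, by omega,
    (norm_R_le _ _).trans hz1, ?_, hfb, ?_, ?_, ?_⟩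
  · intro m hm
    rw [hx, co_R]
    split_ifs with h
    · rw [Set.mem_Iio] at h
      rw [← hzN, co_R, if_neg]
      rw [Set.mem_Ici]
      omega
    · rfl
  · simp only [hf, ContinuousLinearMap.smul_apply, ContinuousLinearMap.comp_apply, coL_apply,
      smul_eq_mul, hφ]
    exact inv_mul_cancel₀ hpos.ne'
  · intro y
    refine (hfb _).trans ?_
    have := hM n ((le_max_left _ _).trans hn) y
    calc _ ≤ δ⁻¹ * (δ / 4 * ‖y‖) := by gcongr
      _ = 1 / 4 * ‖y‖ := by field_simp
  · intro y
    exact hN' _ (le_max_left _ _) y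

lemma c0_abs_le (a : c0) (k : ℕ) : |a k| ≤ ‖a‖ :=
  BoundedContinuousFunction.norm_coe_le_norm a.toBCF k

lemma c0_norm_le {a : c0} {C : ℝ} (hC : 0 ≤ C) (h : ∀ k, |a k| ≤ C) : ‖a‖ ≤ C :=
  (BoundedContinuousFunction.norm_le (f := a.toBCF) hC).2 h

lemma c0_tendsto (a : c0) : Tendsto (fun k => a k) atTop (𝓝 0) := by
  have := zero_at_infty a
  rwa [cocompact_eq_cofinite, Nat.cofinite_eq_atTop] at this

/-- Constructor for elements of `c₀`. -/
def c0mk (f : ℕ → ℝ) (h : Tendsto f atTop (𝓝 0)) : c0 :=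
  ⟨⟨f, continuous_of_discreteTopology⟩, by
    rw [cocompact_eq_cofinite, Nat.cofinite_eq_atTop]; exact h⟩

@[simp] lemma c0mk_apply (f : ℕ → ℝ) (h) (k : ℕ) : c0mk f h k = f k := rfl

lemma factor (T : Xsp →L[ℝ] Xsp) (hT : ¬ IsCompactOperator (T : Xsp → Xsp)) :
    ∃ A : c0 →L[ℝ] Xsp, ∃ B : Xsp →L[ℝ] c0,
      B.comp (T.comp A) = ContinuousLinearMap.id ℝ c0 := by
  obtain ⟨C, hC, hst⟩ := step T hT
  choose x n f N' h1 h2 h3 h4 h5 h6 h7 h8 using hst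
  set P : ℕ → ℕ := fun k => N'^[k] 0 with hP
  have hPs : ∀ k, P (k + 1) = N' (P k) := fun k => Function.iterate_succ_apply' _ _ _
  have hPlt : StrictMono P := strictMono_nat_of_lt_succ fun k => by
    rw [hPs]; exact (h1 _).trans_lt (h2 _)
  have hnP : ∀ k, k ≤ n (P k) := fun k => (hPlt.id_le k).trans (h1 _)
  -- each coordinate meets at most one block
  have hsupp : ∀ k m, co (x (P k)) m ≠ 0 → P k ≤ m ∧ m < P (k + 1) := by
    intro k m hm
    rw [hPs]
    by_contra hcon
    exact hm (h4 _ _ (by omega))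
  have huniq : ∀ k j m, P k ≤ m → m < P (k + 1) → j ≠ k → co (x (P j)) m = 0 := by
    intro k j m hk hk' hj
    by_contra hne
    obtain ⟨h, h'⟩ := hsupp j m hne
    rcases lt_or_gt_of_ne hj with hlt | hlt
    · have := hPlt.monotone (show j + 1 ≤ k from hlt)
      omega
    · have := hPlt.monotone (show k + 1 ≤ j from hlt)
      omega
  have hex : ∀ m, ∃ k, P k ≤ m ∧ m < P (k + 1) := by
    intro m
    have hm : ∃ k, m < P (k + 1) := ⟨m, hPlt.id_le (m + 1)⟩
    classical
    refine ⟨Nat.find hm, ?_, Nat.find_spec hm⟩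
    rcases Nat.eq_zero_or_pos (Nat.find hm) with h0 | h0
    · rw [h0]; simp [hP]
    · have := Nat.find_min hm (m := Nat.find hm - 1) (by omega)
      rw [Nat.sub_add_cancel h0] at this
      omega
  choose κ hκ1 hκ2 using hex
  have hκ : ∀ k m, P k ≤ m → m < P (k + 1) → κ m = k := by
    intro k m hk hk'
    by_contra hne
    rcases lt_or_gt_of_ne hne with hlt | hlt
    · have := hPlt.monotone (show κ m + 1 ≤ k from hlt)
      have := hκ2 m
      omega
    · have := hPlt.monotone (show k + 1 ≤ κ m from hlt)
      have := hκ1 m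
      omega
  have hκt : Tendsto κ atTop atTop := by
    refine tendsto_atTop.2 fun b => ?_
    filter_upwards [eventually_ge_atTop (P b)] with m hm
    by_contra hlt
    have := hPlt.monotone (show κ m + 1 ≤ b by omega)
    have := hκ2 m
    omega
  have hbd : ∀ (a : c0) m, ‖a (κ m) • co (x (P (κ m))) m‖ ≤ |a (κ m)| := by
    intro a m
    rw [norm_smul, Real.norm_eq_abs]
    exact mul_le_of_le_one_right (abs_nonneg _) ((norm_co_le _ _).trans (h3 _))
  let A : c0 →L[ℝ] Xsp := LinearMap.mkContinuous
    { toFun := fun a => mk (fun m => a (κ m) • co (x (P (κ m))) m)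
        (squeeze_zero (fun _ => norm_nonneg _) (hbd a)
          (by simpa using ((c0_tendsto a).comp hκt).abs))
      map_add' := fun a b => by
        ext1 m
        simp [add_smul]
      map_smul' := fun c a => by
        ext1 m
        simp [mul_smul] } 1
    (fun a => by
      rw [one_mul]
      exact norm_le (norm_nonneg _) fun m => (hbd a m).trans (c0_abs_le a _))
  have hA : ∀ a m, co (A a) m = a (κ m) • co (x (P (κ m))) m := fun a m => rfl
  have hAn : ∀ a, ‖A a‖ ≤ ‖a‖ := fun a =>
    norm_le (norm_nonneg _) fun m => (hbd a m).trans (c0_abs_le a _)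
  have hnt : Tendsto (fun k => n (P k)) atTop atTop := tendsto_atTop_mono hnP tendsto_id
  let B : Xsp →L[ℝ] c0 := LinearMap.mkContinuous
    { toFun := fun y => c0mk (fun k => f (P k) y)
        (squeeze_zero_norm (fun k => h5 (P k) y)
          (by simpa using ((co_tendsto y).comp hnt).const_mul C))
      map_add' := fun a b => by
        ext k
        simp
      map_smul' := fun c a => by
        ext k
        simp } C
    (fun y => c0_norm_le (by positivity) fun k => (h5 _ y).trans (by
      gcongr
      exact norm_co_le _ _))
  have hB : ∀ y k, B y k = f (P k) y := fun y k => rfl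
  set S : c0 →L[ℝ] c0 := B.comp (T.comp A) with hS
  have hdec : ∀ a k, A a = R (Set.Iio (P k)) (A a) + a k • x (P k) +
      R (Set.Ici (P (k + 1))) (A a) := by
    intro a k
    ext1 m
    have hlt : P k < P (k + 1) := hPlt (Nat.lt_succ_self k)
    simp only [co_add, co_R, co_smul, Set.mem_Iio, Set.mem_Ici]
    by_cases c1 : m < P k
    · rw [if_pos c1, if_neg (by omega), h4 (P k) m (Or.inl c1)]
      simp
    · by_cases c2 : m < P (k + 1)
      · rw [if_neg c1, if_neg (by omega), hA, hκ k m (by omega) c2]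
        simp
      · rw [if_neg c1, if_pos (by omega), h4 (P k) m (Or.inr (by rw [← hPs]; omega))]
        simp
  have hclose : ‖ContinuousLinearMap.id ℝ c0 - S‖ < 1 := by
    refine lt_of_le_of_lt (ContinuousLinearMap.opNorm_le_bound _ (M := 1 / 2) (by norm_num)
      fun a => ?_) (by norm_num)
    refine c0_norm_le (by positivity) fun k => ?_
    have e1 : (ContinuousLinearMap.id ℝ c0 - S) a k = a k - f (P k) (T (A a)) := rfl
    have e2 : f (P k) (T (A a)) = f (P k) (T (R (Set.Iio (P k)) (A a))) + a k +
        f (P k) (T (R (Set.Ici (P (k + 1))) (A a))) := by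
      conv_lhs => rw [hdec a k]
      simp [h6]
    rw [e1, e2]
    have b1 := h7 (P k) (A a)
    have b2 := h8 (P k) (A a)
    rw [← hPs] at b2
    have b3 := hAn a
    rw [abs_le] at b1 b2 ⊢
    constructor <;> linarith
  let u := Units.oneSub (R := c0 →L[ℝ] c0) (ContinuousLinearMap.id ℝ c0 - S) hclose
  have hu : (u : c0 →L[ℝ] c0) = S := by
    change (1 : c0 →L[ℝ] c0) - (1 - S) = S
    abel
  refine ⟨A.comp ((u⁻¹ : (c0 →L[ℝ] c0)ˣ) : c0 →L[ℝ] c0), B, ?_⟩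
  have : S * ((u⁻¹ : (c0 →L[ℝ] c0)ˣ) : c0 →L[ℝ] c0) = 1 := by
    rw [← hu]; exact u.mul_inv
  exact this

end NC

/-- **Non-compact operators factor the identity of `c₀`.** If `T` is a non-compact
operator on `X = (⊕ₙ ℓ₁ⁿ)_{c₀}`, then `id_{c₀}` factors through `T`; consequently every
closed two-sided ideal containing `T` contains `𝒢̄_{c₀}(X)`. -/
theorem noncompact_factors_c0 (T : Xsp →L[ℝ] Xsp)
    (hT : ¬ IsCompactOperator (T : Xsp → Xsp)) :
    (∃ A : c0 →L[ℝ] Xsp, ∃ B : Xsp →L[ℝ] c0,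
      B.comp (T.comp A) = ContinuousLinearMap.id ℝ c0) ∧
    (∀ S : Set (Xsp →L[ℝ] Xsp), IsClosedOperatorIdeal S → T ∈ S →
      closure GcoSet ⊆ S) := by
  obtain ⟨A, B, hAB⟩ := NC.factor T hT
  refine ⟨⟨A, B, hAB⟩, fun S hS hTS => ?_⟩
  obtain ⟨hcl, -, -, hid⟩ := hS
  refine closure_minimal ?_ hcl
  rintro U ⟨A', B', rfl⟩
  have h1 := (hid T hTS (B'.comp B)).1
  have h2 := (hid _ h1 (A.comp A')).2
  convert h2 using 1
  ext1 x
  have h3 := congrArg (fun F : c0 →L[ℝ] c0 => F (A' x)) hAB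
  simp only [ContinuousLinearMap.comp_apply, ContinuousLinearMap.id_apply] at h3 ⊢
  rw [h3]

end
end
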